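/- Suppose a CAT trajectory satisfies Assumption 1 with constants L, Δ_f ∈ (0,∞). Then for all k ∈ ℕ and all j ≥ k with ε_{j+1} ≥ ε_k/2: if ‖d_j‖ < γ₂r_j or r_{j+1} < ω₂‖d_j‖, then ‖d_j‖ ≥ ω₁γ₂⁻¹·d_min(k), where d_min(k) := γ₂ω₁⁻¹C^{−1/2}L^{−1/2}ε_k^{1/2}. -/

import Mathlib

open scoped RealInnerProductSpace
open Filter

noncomputable section

/-- Application of the Hessian-based quadratic model's gradient:
`∇M_x(d) = ∇²f(x) d + ∇f(x)`. -/
def gradModel {n : ℕ} (f : EuclideanSpace ℝ (Fin n) → ℝ)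
    (x d : EuclideanSpace ℝ (Fin n)) : EuclideanSpace ℝ (Fin n) :=
  fderiv ℝ (gradient f) x d + gradient f x

/-- The quadratic model `M_x(d) = (1/2) dᵀ ∇²f(x) d + ∇f(x)ᵀ d`. -/
def modelVal {n : ℕ} (f : EuclideanSpace ℝ (Fin n) → ℝ)
    (x d : EuclideanSpace ℝ (Fin n)) : ℝ :=
  (1/2) * ⟪fderiv ℝ (gradient f) x d, d⟫ + ⟪gradient f x, d⟫

/-- The ratio `ρ̂` of actual to (modified) predicted reduction; equals `0` when the
denominator is `0` (division by zero convention). -/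
def rhoHat {n : ℕ} (θ : ℝ) (f : EuclideanSpace ℝ (Fin n) → ℝ)
    (x d : EuclideanSpace ℝ (Fin n)) : ℝ :=
  (f x - f (x + d)) /
    (-(modelVal f x d) + (θ/2) * min ‖gradient f x‖ ‖gradient f (x + d)‖ * ‖d‖)

/-- A CAT trajectory (Algorithm 1, with `σ = 0`): sequences of iterates `x`, directions `d`,
radii `r`, multipliers `δ`, gradient-norm estimates `ε` and thresholds `b` (in `(0,∞]`,
modeled as `EReal`), indexed from `k = 1`. -/
structure CATTraj {n : ℕ} (θ β ω₁ ω₂ γ₁ γ₂ γ₃ ξ : ℝ)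
    (f : EuclideanSpace ℝ (Fin n) → ℝ)
    (x d : ℕ → EuclideanSpace ℝ (Fin n))
    (r δ ε : ℕ → ℝ) (b : ℕ → EReal) : Prop where
  hf : ∀ y, DifferentiableAt ℝ f y
  hf' : ∀ y, DifferentiableAt ℝ (gradient f) y
  r_pos : ∀ k, 1 ≤ k → 0 < r k
  δ_nonneg : ∀ k, 1 ≤ k → 0 ≤ δ k
  ε_pos : ∀ k, 1 ≤ k → 0 < ε k
  b_pos : ∀ k, 1 ≤ k → 0 < b k
  sub_grad : ∀ k, 1 ≤ k → ‖gradModel f (x k) (d k) + δ k • d k‖ ≤ γ₁ * ε k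
  sub_comp : ∀ k, 1 ≤ k → γ₂ * δ k * r k ≤ δ k * ‖d k‖
  sub_rad : ∀ k, 1 ≤ k → ‖d k‖ ≤ r k
  sub_decr : ∀ k, 1 ≤ k → modelVal f (x k) (d k) ≤ -(γ₃ * (δ k / 2) * ‖d k‖ ^ 2)
  step_acc : ∀ k, 1 ≤ k → f (x k + d k) ≤ f (x k) → x (k+1) = x k + d k
  step_rej : ∀ k, 1 ≤ k → ¬ f (x k + d k) ≤ f (x k) → x (k+1) = x k
  radius_succ : ∀ k, 1 ≤ k → β ≤ rhoHat θ f (x k) (d k) →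
    r (k+1) = max (ω₂ * ‖d k‖) (r k)
  radius_fail : ∀ k, 1 ≤ k → ¬ β ≤ rhoHat θ f (x k) (d k) → r (k+1) = r k / ω₁
  eps_one : ε 1 = ‖gradient f (x 1)‖
  eps_succ_dec : ∀ k, 1 ≤ k → (f (x k + d k) : EReal) ≤ (f (x k) : EReal) + b k →
    ε (k+1) = min (ε k) ‖gradient f (x k + d k)‖
  eps_succ_keep : ∀ k, 1 ≤ k → ¬ ((f (x k + d k) : EReal) ≤ (f (x k) : EReal) + b k) →
    ε (k+1) = ε k
  b_lb : ∀ k, 1 ≤ k → ((ξ * ε k * ‖d k‖ : ℝ) : EReal) ≤ b k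

/-- Assumption 1: bounded optimality gap along the trajectory, and the two
Lipschitz-Hessian-type inequalities along the steps. -/
def Assumption1 {n : ℕ} (L Δf : ℝ) (f : EuclideanSpace ℝ (Fin n) → ℝ)
    (x d : ℕ → EuclideanSpace ℝ (Fin n)) : Prop :=
  ∀ k, 1 ≤ k →
    f (x 1) - f (x k) ≤ Δf ∧
    ‖gradient f (x k + d k)‖ ≤ ‖gradModel f (x k) (d k)‖ + (L/2) * ‖d k‖ ^ 2 ∧
    f (x k + d k) ≤ f (x k) + modelVal f (x k) (d k) + (L/6) * ‖d k‖ ^ 3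

/-- `c₁ := (2 + 3γ₃(1−β))/(6(γ₃(1−β) − βθ))`. -/
def c1Def (θ β γ₃ : ℝ) : ℝ := (2 + 3 * γ₃ * (1 - β)) / (6 * (γ₃ * (1 - β) - β * θ))

/-- `c₂ := γ₃(1−β)/(γ₃(1−β) − βθ)`. -/
def c2Def (θ β γ₃ : ℝ) : ℝ := γ₃ * (1 - β) / (γ₃ * (1 - β) - β * θ)

/-- `C := max{1/(3ξ), 2c₁/(1 − 2γ₁c₂)}`. -/
def CDef (θ β γ₃ γ₁ ξ : ℝ) : ℝ :=
  max (1 / (3 * ξ)) (2 * c1Def θ β γ₃ / (1 - 2 * γ₁ * c2Def θ β γ₃))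

/-- `d_min` as a function of the value `e = ε_k`:
`γ₂ ω₁⁻¹ C^{-1/2} L^{-1/2} e^{1/2}`. -/
def dminDef (γ₂ ω₁ C L e : ℝ) : ℝ :=
  γ₂ * ω₁⁻¹ * (Real.sqrt C)⁻¹ * (Real.sqrt L)⁻¹ * Real.sqrt e

/-- `d_max` as a function of the value `e = ε_k`: `(2ω₂/(βθ)) Δf / e`. -/
def dmaxDef (ω₂ β θ Δf e : ℝ) : ℝ := (2 * ω₂ / (β * θ)) * (Δf / e)

namespace CATTraj

variable {n : ℕ} {θ β ω₁ ω₂ γ₁ γ₂ γ₃ ξ L Δf : ℝ} {f : EuclideanSpace ℝ (Fin n) → ℝ}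
  {x d : ℕ → EuclideanSpace ℝ (Fin n)} {r δ ε : ℕ → ℝ} {b : ℕ → EReal}

theorem eps_succ_le (traj : CATTraj θ β ω₁ ω₂ γ₁ γ₂ γ₃ ξ f x d r δ ε b) {j : ℕ} (hj : 1 ≤ j) :
    ε (j + 1) ≤ ε j := by
  by_cases h : (f (x j + d j) : EReal) ≤ (f (x j) : EReal) + b j
  · rw [traj.eps_succ_dec j hj h]
    exact min_le_left _ _
  · exact (traj.eps_succ_keep j hj h).le

theorem eps_antitone (traj : CATTraj θ β ω₁ ω₂ γ₁ γ₂ γ₃ ξ f x d r δ ε b) {k j : ℕ}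
    (hk : 1 ≤ k) (hkj : k ≤ j) : ε j ≤ ε k := by
  induction j, hkj using Nat.le_induction with
  | base => exact le_rfl
  | succ m hm ih => exact (traj.eps_succ_le (hk.trans hm)).trans ih

/-- If the step does not increase `f` by more than `ξ ε_j ‖d_j‖`, then `ε_{j+1}` is at most the
gradient norm at the trial point. -/
theorem eps_succ_le_norm_gradient (traj : CATTraj θ β ω₁ ω₂ γ₁ γ₂ γ₃ ξ f x d r δ ε b) {j : ℕ}
    (hj : 1 ≤ j) (h : f (x j + d j) ≤ f (x j) + ξ * ε j * ‖d j‖) :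
    ε (j + 1) ≤ ‖gradient f (x j + d j)‖ := by
  have h' : (f (x j + d j) : EReal) ≤ (f (x j) : EReal) + b j :=
    calc (f (x j + d j) : EReal) ≤ ((f (x j) + ξ * ε j * ‖d j‖ : ℝ) : EReal) :=
          EReal.coe_le_coe_iff.2 h
      _ = (f (x j) : EReal) + ((ξ * ε j * ‖d j‖ : ℝ) : EReal) := EReal.coe_add _ _
      _ ≤ (f (x j) : EReal) + b j := add_le_add le_rfl (traj.b_lb j hj)
  rw [traj.eps_succ_dec j hj h']
  exact min_le_right _ _

theorem modelVal_nonpos (traj : CATTraj θ β ω₁ ω₂ γ₁ γ₂ γ₃ ξ f x d r δ ε b) (hγ₃ : 0 < γ₃)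
    {j : ℕ} (hj : 1 ≤ j) : modelVal f (x j) (d j) ≤ 0 := by
  have hδ := traj.δ_nonneg j hj
  have h := traj.sub_decr j hj
  have : 0 ≤ γ₃ * (δ j / 2) * ‖d j‖ ^ 2 := by positivity
  linarith

theorem norm_gradModel_le (traj : CATTraj θ β ω₁ ω₂ γ₁ γ₂ γ₃ ξ f x d r δ ε b) {j : ℕ}
    (hj : 1 ≤ j) : ‖gradModel f (x j) (d j)‖ ≤ γ₁ * ε j + δ j * ‖d j‖ := by
  calc ‖gradModel f (x j) (d j)‖
      = ‖(gradModel f (x j) (d j) + δ j • d j) - δ j • d j‖ := by rw [add_sub_cancel_right]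
    _ ≤ ‖gradModel f (x j) (d j) + δ j • d j‖ + ‖δ j • d j‖ := norm_sub_le _ _
    _ ≤ γ₁ * ε j + δ j * ‖d j‖ := by
      rw [norm_smul, Real.norm_of_nonneg (traj.δ_nonneg j hj)]
      gcongr
      exact traj.sub_grad j hj

/-- The multiplier vanishes at an interior subproblem solution. -/
theorem multiplier_eq_zero (traj : CATTraj θ β ω₁ ω₂ γ₁ γ₂ γ₃ ξ f x d r δ ε b) {j : ℕ}
    (hj : 1 ≤ j) (h : ‖d j‖ < γ₂ * r j) : δ j = 0 := by
  by_contra hne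
  have hpos := (traj.δ_nonneg j hj).lt_of_ne' hne
  have := traj.sub_comp j hj
  nlinarith [mul_lt_mul_of_pos_left h hpos]

/-- On an unsuccessful step, the multiplier is controlled by the gradient norm at the trial
point. -/
theorem multiplier_le_of_rhoHat_lt (traj : CATTraj θ β ω₁ ω₂ γ₁ γ₂ γ₃ ξ f x d r δ ε b)
    (hA : Assumption1 L Δf f x d) (hθ : 0 < θ) (hβ : 0 < β ∧ β < 1) (hγ₃ : 0 < γ₃)
    (hL : 0 < L) {j : ℕ} (hj : 1 ≤ j) (hd : 0 < ‖d j‖) (hρ : rhoHat θ f (x j) (d j) < β) :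
    γ₃ * (1 - β) * (δ j * ‖d j‖) ≤
      β * θ * ‖gradient f (x j + d j)‖ + L / 3 * ‖d j‖ ^ 2 := by
  obtain ⟨-, -, hf⟩ := hA j hj
  have hM := traj.modelVal_nonpos hγ₃ hj
  have hdecr := traj.sub_decr j hj
  have hg := norm_nonneg (gradient f (x j + d j))
  unfold rhoHat at hρ
  have hmin : min ‖gradient f (x j)‖ ‖gradient f (x j + d j)‖ ≤ ‖gradient f (x j + d j)‖ :=
    min_le_right _ _
  have hmin0 : 0 ≤ min ‖gradient f (x j)‖ ‖gradient f (x j + d j)‖ := by positivity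
  generalize min ‖gradient f (x j)‖ ‖gradient f (x j + d j)‖ = m at *
  generalize modelVal f (x j) (d j) = M at *
  generalize ‖gradient f (x j + d j)‖ = g at *
  generalize ‖d j‖ = D at *
  have hprod : 0 ≤ θ / 2 * m * D := by positivity
  have hred : (1 - β) * (-M) ≤ β * (θ / 2 * g * D) + L / 6 * D ^ 3 := by
    rcases (show 0 ≤ -M + θ / 2 * m * D by linarith).eq_or_lt' with h0 | hpos
    · have hM0 : M = 0 := by linarith
      have := hβ.1
      rw [hM0]
      simp only [neg_zero, mul_zero]
      positivity
    · rw [div_lt_iff₀ hpos] at hρ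
      have : β * (θ / 2 * m * D) ≤ β * (θ / 2 * g * D) := by
        have := hβ.1
        gcongr
      linarith
  have hlow : (1 - β) * (γ₃ * (δ j / 2) * D ^ 2) ≤ (1 - β) * (-M) :=
    mul_le_mul_of_nonneg_left (by linarith) (by linarith [hβ.2])
  refine le_of_mul_le_mul_right ?_ hd
  nlinarith

/-- An unsuccessful step, or one with an interior subproblem solution, has small multiplier. -/
theorem multiplier_le (traj : CATTraj θ β ω₁ ω₂ γ₁ γ₂ γ₃ ξ f x d r δ ε b)
    (hA : Assumption1 L Δf f x d) (hθ : 0 < θ) (hβ : 0 < β ∧ β < 1)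
    (hω₂ : 0 < ω₂) (hγ₃ : 0 < γ₃) (hL : 0 < L) {j : ℕ} (hj : 1 ≤ j)
    (h : ‖d j‖ < γ₂ * r j ∨ r (j + 1) < ω₂ * ‖d j‖) :
    γ₃ * (1 - β) * (δ j * ‖d j‖) ≤
      β * θ * ‖gradient f (x j + d j)‖ + L / 3 * ‖d j‖ ^ 2 := by
  rcases h with h | h
  · have := hβ.1
    rw [traj.multiplier_eq_zero hj h, zero_mul, mul_zero]
    positivity
  · have hρ : ¬ β ≤ rhoHat θ f (x j) (d j) := fun hle =>
      h.not_ge (traj.radius_succ j hj hle ▸ le_max_left _ _)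
    have hr : 0 < r (j + 1) := traj.r_pos _ (by omega)
    exact traj.multiplier_le_of_rhoHat_lt hA hθ hβ hγ₃ hL hj
      (pos_of_mul_pos_right (hr.trans h) hω₂.le) (not_le.1 hρ)

end CATTraj

theorem mul_lt_gap_of_lt_half_mul {θ β γ₁ γ₃ : ℝ} (hβ : β < 1) (hγ₃ : 0 < γ₃)
    (hγ₁ : γ₁ < (1/2) * (1 - β * θ / (γ₃ * (1 - β)))) :
    2 * γ₁ * (γ₃ * (1 - β)) < γ₃ * (1 - β) - β * θ := by
  have ha : 0 < γ₃ * (1 - β) := mul_pos hγ₃ (by linarith)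
  calc 2 * γ₁ * (γ₃ * (1 - β))
      < (1 - β * θ / (γ₃ * (1 - β))) * (γ₃ * (1 - β)) := by gcongr; linarith
    _ = γ₃ * (1 - β) - β * θ := by rw [sub_mul, one_mul, div_mul_cancel₀ _ ha.ne']

theorem mul_dminDef {γ₂ ω₁ C L e : ℝ} (hγ₂ : 0 < γ₂) (hω₁ : 0 < ω₁) (hC : 0 < C) :
    ω₁ * γ₂⁻¹ * dminDef γ₂ ω₁ C L e = √e / √(C * L) := by
  unfold dminDef
  rw [Real.sqrt_mul hC.le]
  field_simp

/-- claim (12) in the paper: if the subproblem solution is interior or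
the step is unsuccessful, the direction is not too small. -/
theorem direction_not_small {n : ℕ} (hn : 1 ≤ n) (θ β ω₁ ω₂ γ₁ γ₂ γ₃ ξ L Δf : ℝ)
    (hθ : 0 < θ ∧ θ < 1) (hβ : 0 < β ∧ β < 1)
    (hω₁ : 1 < ω₁) (hω₂ : ω₁ ≤ ω₂)
    (hγ₃ : 0 < γ₃ ∧ γ₃ ≤ 1) (hγ₂ : ω₁⁻¹ < γ₂ ∧ γ₂ ≤ 1)
    (hγ₁ : 0 ≤ γ₁ ∧ γ₁ < (1/2) * (1 - β * θ / (γ₃ * (1 - β))))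
    (hξ : 0 < ξ)
    (f : EuclideanSpace ℝ (Fin n) → ℝ)
    (x d : ℕ → EuclideanSpace ℝ (Fin n)) (r δ ε : ℕ → ℝ) (b : ℕ → EReal)
    (traj : CATTraj θ β ω₁ ω₂ γ₁ γ₂ γ₃ ξ f x d r δ ε b)
    (hL : 0 < L) (hΔf : 0 < Δf) (hA : Assumption1 L Δf f x d) :
    ∀ k : ℕ, 1 ≤ k → ∀ j : ℕ, k ≤ j → ε k / 2 ≤ ε (j+1) →
      (‖d j‖ < γ₂ * r j ∨ r (j+1) < ω₂ * ‖d j‖) →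
      ω₁ * γ₂⁻¹ * dminDef γ₂ ω₁ (CDef θ β γ₃ γ₁ ξ) L (ε k) ≤ ‖d j‖ := by
  intro k hk j hkj hε hstep
  have hj : 1 ≤ j := hk.trans hkj
  have hω₁0 : 0 < ω₁ := by linarith
  have hγ₂0 : 0 < γ₂ := (inv_pos.2 hω₁0).trans hγ₂.1
  have hgap := mul_lt_gap_of_lt_half_mul hβ.2 hγ₃.1 hγ₁.2
  have ha : 0 < γ₃ * (1 - β) := mul_pos hγ₃.1 (by linarith [hβ.2])
  have hgap0 : 0 < γ₃ * (1 - β) - β * θ := (mul_nonneg (by linarith) ha.le).trans_lt hgap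
  set C := CDef θ β γ₃ γ₁ ξ with hCdef
  have hCξ : 1 / (3 * ξ) ≤ C := le_max_left _ _
  have hC : 0 < C := lt_of_lt_of_le (by positivity) hCξ
  have hC' : (2 + 3 * (γ₃ * (1 - β))) / 3 ≤
      C * (γ₃ * (1 - β) - β * θ - 2 * γ₁ * (γ₃ * (1 - β))) := by
    rw [← div_le_iff₀ (by linarith)]
    refine le_of_eq_of_le ?_ (le_max_right _ _)
    unfold c1Def c2Def
    have h₁ : γ₃ * (1 - β) - β * θ - 2 * γ₁ * (γ₃ * (1 - β)) ≠ 0 := by linarith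
    have h₂ : 1 - 2 * γ₁ * (γ₃ * (1 - β) / (γ₃ * (1 - β) - β * θ)) =
        (γ₃ * (1 - β) - β * θ - 2 * γ₁ * (γ₃ * (1 - β))) / (γ₃ * (1 - β) - β * θ) := by
      field_simp
    rw [h₂]
    generalize γ₃ * (1 - β) - β * θ - 2 * γ₁ * (γ₃ * (1 - β)) = q at *
    generalize γ₃ * (1 - β) - β * θ = p at *
    field_simp
    ring
  rw [mul_dminDef hγ₂0 hω₁0 hC, div_le_iff₀ (by positivity)]
  refine Real.sqrt_le_iff.2 ⟨by positivity, ?_⟩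
  rw [mul_pow, Real.sq_sqrt (by positivity)]
  by_contra! hlt
  obtain ⟨-, hgrad, hval⟩ := hA j hj
  have hεj : ε k / 2 ≤ ε j := hε.trans (traj.eps_succ_le hj)
  have hdec : f (x j + d j) ≤ f (x j) + ξ * ε j * ‖d j‖ := by
    have hM := traj.modelVal_nonpos hγ₃.1 hj
    have h₁ : 1 ≤ C * (3 * ξ) := (div_le_iff₀ (by positivity)).1 hCξ
    have h₂ : L * ‖d j‖ ^ 2 ≤ 6 * (ξ * ε j) := by
      have h₃ : 1 * (L * ‖d j‖ ^ 2) ≤ C * (3 * ξ) * (L * ‖d j‖ ^ 2) := by gcongr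
      have h₄ : 3 * ξ * (‖d j‖ ^ 2 * (C * L)) ≤ 3 * ξ * ε k := by gcongr
      have h₅ : 3 * ξ * ε k ≤ 3 * ξ * (2 * ε j) := by gcongr; linarith
      linarith
    have h₃ := mul_le_mul_of_nonneg_right h₂ (norm_nonneg (d j))
    linarith
  have hg : ε k / 2 ≤ ‖gradient f (x j + d j)‖ :=
    hε.trans (traj.eps_succ_le_norm_gradient hj hdec)
  have hmult := traj.multiplier_le hA hθ.1 hβ (hω₁0.trans_le hω₂) hγ₃.1 hL hj hstep
  have hmodel := traj.norm_gradModel_le hj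
  have hγε : γ₁ * ε j ≤ γ₁ * ε k :=
    mul_le_mul_of_nonneg_left (traj.eps_antitone hk hkj) hγ₁.1
  have hgrad' : γ₃ * (1 - β) * ‖gradient f (x j + d j)‖ ≤
      γ₃ * (1 - β) * (γ₁ * ε k + δ j * ‖d j‖ + L / 2 * ‖d j‖ ^ 2) :=
    mul_le_mul_of_nonneg_left (by linarith) ha.le
  have hlow := mul_le_mul_of_nonneg_left hg hgap0.le
  have hC'' := mul_le_mul_of_nonneg_right hC' (show 0 ≤ L * ‖d j‖ ^ 2 by positivity)
  have hlt' := mul_lt_mul_of_pos_right hlt (sub_pos.2 hgap)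
  generalize γ₃ * (1 - β) = a at *
  generalize β * θ = p at *
  nlinarith
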